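/- The vectors v_{(s,k)}, for s ∈ {0,1,…,N−1} and strictly increasing k ∈ I(d+1,N+1), span the vector space Δ^{(2,1^{N−1})}Sym^d E = ker(μ_N : ⋀^N Sym^d E ⊗ Sym^d E → ⋀^{N+1} Sym^d E). -/

import Mathlib

open MvPolynomial TensorProduct

set_option maxHeartbeats 1000000
set_option synthInstance.maxHeartbeats 400000

noncomputable section

/-- `Sym' F c` : the `c`-th symmetric power of `E = F²`, realised as the space of
homogeneous polynomials of degree `c` in the two variables `X = X 0`, `Y = X 1`. -/
abbrev Sym' (F : Type*) [Field F] (c : ℕ) : Type _ :=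
  ↥(MvPolynomial.homogeneousSubmodule (Fin 2) F c)

variable (F : Type*) [Field F]

/-- The basis monomial `X^(c-i) Y^i` of `Sym' F c`; it is `0` (junk) if `i > c`. -/
def XY (c i : ℕ) : Sym' F c :=
  if h : i ≤ c then
    ⟨(X 0 : MvPolynomial (Fin 2) F) ^ (c - i) * X 1 ^ i, by
      rw [MvPolynomial.mem_homogeneousSubmodule]
      have := ((isHomogeneous_X_pow (R := F) (0 : Fin 2) (c - i)).mul
        (isHomogeneous_X_pow (R := F) (1 : Fin 2) i))
      rwa [Nat.sub_add_cancel h] at this⟩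
  else 0

/-- `F_∧^{(c)}(k) = X^{c-k₁}Y^{k₁} ∧ ⋯ ∧ X^{c-k_r}Y^{k_r}` in `⋀^r (Sym' F c)`. -/
def wedge (c : ℕ) {r : ℕ} (k : Fin r → ℕ) : ⋀[F]^r (Sym' F c) :=
  ⟨ExteriorAlgebra.ιMulti F r fun a => XY F c (k a),
    ExteriorAlgebra.ιMulti_range F r (Set.mem_range_self _)⟩

/-- `F(i,j) = F_∧^{(d)}(i) ⊗ X^{d-j}Y^j`. -/
def Fp (d : ℕ) {N : ℕ} (i : Fin N → ℕ) (j : ℕ) :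
    (⋀[F]^N (Sym' F d)) ⊗[F] (Sym' F d) :=
  wedge F d i ⊗ₜ[F] XY F d j

/-- The multiplication map `μ_N : ⋀^N V ⊗ V → ⋀^{N+1} V` for `V = Sym' F c`. -/
def mu (c N : ℕ) :
    ((⋀[F]^N (Sym' F c)) ⊗[F] (Sym' F c)) →ₗ[F] ⋀[F]^(N + 1) (Sym' F c) :=
  TensorProduct.lift
    (LinearMap.mk₂ F
      (fun w v => ⟨(w : ExteriorAlgebra F (Sym' F c)) * ExteriorAlgebra.ι F v, by
        have h := Submodule.mul_mem_mul w.2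
          (LinearMap.mem_range_self (ExteriorAlgebra.ι F (M := Sym' F c)) v)
        rwa [← pow_succ] at h⟩)
      (fun w w' v => by ext; simp [add_mul])
      (fun a w v => by ext; simp [mul_assoc, Algebra.smul_mul_assoc])
      (fun w v v' => by ext; simp [mul_add])
      (fun a w v => by ext; simp [Algebra.mul_smul_comm]))

/-- The box `B(k) = [k₁,k₂) × ⋯ × [k_N, k_{N+1})` as a finset of multi-indices. -/
def box {N : ℕ} (k : Fin (N + 1) → ℕ) : Finset (Fin N → ℕ) :=
  Fintype.piFinset fun a : Fin N => Finset.Ico (k a.castSucc) (k a.succ)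

/-- `v_{(s,k)} = Σ_{i ∈ B(k)} F(i, s + |k| - N - |i|)`. -/
def vv (d N : ℕ) (s : ℕ) (k : Fin (N + 1) → ℕ) :
    (⋀[F]^N (Sym' F d)) ⊗[F] (Sym' F d) :=
  ∑ i ∈ box k, Fp F d i (s + (∑ a, k a) - N - ∑ a, i a)

/-- A pair `(i, j)` is semistandard (with entries in `{0,…,d}`). -/
def IsSS (d : ℕ) {N : ℕ} (p : (Fin N → ℕ) × ℕ) : Prop :=
  StrictMono p.1 ∧ (∀ a, p.1 a ≤ d) ∧ p.2 ≤ d ∧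
    ∀ a : Fin N, (a : ℕ) = 0 → p.1 a ≤ p.2

/-- The neighbour map `P`. -/
def Pmap {N : ℕ} (p : (Fin N → ℕ) × ℕ) : (Fin N → ℕ) × ℕ :=
  if h : (Finset.univ.filter fun a : Fin N => p.1 a ≤ p.2).Nonempty then
    let α := (Finset.univ.filter fun a : Fin N => p.1 a ≤ p.2).max' h
    (Function.update p.1 α p.2, p.1 α)
  else p

/-- `F_Δ(i,j)`. -/
def FDelta (d : ℕ) {N : ℕ} (p : (Fin N → ℕ) × ℕ) :
    (⋀[F]^N (Sym' F d)) ⊗[F] (Sym' F d) :=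
  if ∃ a, p.1 a = p.2 then Fp F d p.1 p.2
  else Fp F d p.1 p.2 + Fp F d (Pmap p).1 (Pmap p).2

/-- The content multiset of a pair. -/
def ssContent {N : ℕ} (p : (Fin N → ℕ) × ℕ) : Multiset ℕ :=
  p.2 ::ₘ Finset.univ.val.map p.1


theorem mem_of_add_mem {R M : Type*} [Ring R] [AddCommMonoid M] [Module R M] (W : Submodule R M)
    {x y : M} (hy : y ∈ W) (h : x + y ∈ W) : x ∈ W := by
  have h1 : x + y + (-1 : R) • y = x := by
    have h2 : y + (-1 : R) • y = 0 := by
      have h3 : (1 : R) • y + (-1 : R) • y = 0 := by rw [← add_smul]; simp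
      rwa [one_smul] at h3
    rw [add_assoc, h2, add_zero]
  rw [← h1]
  exact W.add_mem h (W.smul_mem _ hy)

theorem key_compare {N : ℕ} (s s' : ℕ) (k k' : Fin (N + 1) → ℕ) (hs' : s' < N)
    (h1 : ∀ a : Fin (N + 1), (a : ℕ) < s' → k a ≤ k' a) (h2 : ∀ a : Fin (N + 1), s' < (a : ℕ) → k' a ≤ k a)
    (hsum : s + ∑ a, k a = s' + ∑ a, k' a) :
    (s = s' ∧ k = k') ∨
      toLex (fun m : Fin (N + 1) => 2 * k m + if s = m then 0 else 1) <
      toLex (fun m : Fin (N + 1) => 2 * k' m + if s' = m then 0 else 1) := by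
  classical
  have main : s' ≤ s → (∀ a, k' a ≤ k a) → s = s' ∧ k = k' := by
    intro hs hk
    have h3 : ∑ a, k' a ≤ ∑ a, k a := Finset.sum_le_sum fun a _ => hk a
    have h4 : ∑ a, k' a = ∑ a, k a := by omega
    refine ⟨by omega, ?_⟩
    funext a
    exact ((Finset.sum_eq_sum_iff_of_le (fun a _ => hk a)).1 h4 a (Finset.mem_univ a)).symm
  by_cases hkey : ∃ m : Fin (N + 1), (2 * k m + if s = m then 0 else 1) ≠
      (2 * k' m + if s' = m then 0 else 1)
  · let P : ℕ → Prop := fun n => ∃ h : n < N + 1, (2 * k ⟨n, h⟩ + if s = n then 0 else 1) ≠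
      (2 * k' ⟨n, h⟩ + if s' = n then 0 else 1)
    have hP : ∃ n, P n := by
      obtain ⟨m, hm⟩ := hkey
      exact ⟨m, m.2, hm⟩
    obtain ⟨hlt, hne⟩ := Nat.find_spec hP
    have hmin : ∀ a : Fin (N + 1), (a : ℕ) < Nat.find hP →
        (2 * k a + if s = a then 0 else 1) = (2 * k' a + if s' = a then 0 else 1) := by
      intro a ha
      by_contra hc
      exact Nat.find_min hP ha ⟨a.2, hc⟩
    generalize Nat.find hP = m at hlt hne hmin
    have low : ∀ a : Fin (N + 1), (a : ℕ) < m → (a : ℕ) < s' → k a = k' a ∧ s ≠ a := by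
      intro a ha ha'
      have := hmin a ha
      rw [if_neg (by omega : ¬ s' = (a : ℕ))] at this
      split_ifs at this <;> omega
    by_cases hms : m < s'
    · right
      refine ⟨⟨m, hlt⟩, fun a ha => hmin a ha, ?_⟩
      have := h1 ⟨m, hlt⟩ hms
      change (2 * k ⟨m, hlt⟩ + if s = m then 0 else 1) < (2 * k' ⟨m, hlt⟩ + if s' = m then 0 else 1)
      rw [if_neg (by omega : ¬ s' = m)] at hne ⊢
      split_ifs at hne ⊢ <;> omega
    · have hge : s' ≤ s := by
        by_contra hc
        exact (low ⟨s, by omega⟩ (by simp; omega) (by simp; omega)).2 rfl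
      by_cases hk : k' ⟨s', by omega⟩ ≤ k ⟨s', by omega⟩
      · left
        refine main hge fun a => ?_
        rcases lt_trichotomy (a : ℕ) s' with h | h | h
        · exact (low a (by omega) h).1.ge
        · have : a = ⟨s', by omega⟩ := Fin.ext h
          rw [this]; exact hk
        · exact h2 a h
      · right
        have hm : m = s' := by
          by_contra hc
          have := hmin ⟨s', by omega⟩ (by simp; omega)
          simp only [if_true] at this
          split_ifs at this <;> omega
        subst hm
        refine ⟨⟨m, hlt⟩, fun a ha => hmin a ha, ?_⟩
        change (2 * k ⟨m, hlt⟩ + if s = m then 0 else 1) < (2 * k' ⟨m, hlt⟩ + if m = m then 0 else 1)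
        rw [if_pos rfl]
        split_ifs <;> omega
  · left
    push Not at hkey
    have h0 := hkey ⟨s', by omega⟩
    simp only [if_true] at h0
    have hss : s = s' := by
      by_contra hc
      rw [if_neg hc] at h0
      omega
    refine ⟨hss, ?_⟩
    funext a
    have := hkey a
    rw [hss] at this
    omega

theorem exists_split {N : ℕ} (i : Fin N → ℕ) (hi : StrictMono i) (j : ℕ) :
    ∃ s ≤ N, ∀ a : Fin N, i a < j ↔ (a : ℕ) < s := by
  classical
  have hP : ∃ n, ∀ a : Fin N, n ≤ (a : ℕ) → j ≤ i a := ⟨N, fun a h => absurd a.2 (by omega)⟩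
  refine ⟨Nat.find hP, Nat.find_min' hP fun a h => absurd a.2 (by omega), fun a => ⟨fun h => ?_, fun h => ?_⟩⟩
  · by_contra hc
    have := Nat.find_spec hP a (by omega)
    omega
  · have := Nat.find_min hP h
    push Not at this
    obtain ⟨b, hb, hb'⟩ := this
    exact lt_of_le_of_lt (hi.monotone hb) hb'

/-- The pair `(i, j)` is the pivot of `(s, k)`. -/
structure IsPiv {N : ℕ} (d s : ℕ) (k : Fin (N + 1) → ℕ) (i : Fin N → ℕ) (j : ℕ) : Prop where
  hs : s < N
  mono : StrictMono k
  bd : ∀ a, k a ≤ d + 1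
  lo : ∀ a : Fin N, (a : ℕ) < s → i a = k a.castSucc
  hi : ∀ a : Fin N, s ≤ (a : ℕ) → i a + 1 = k a.succ
  sum : s + ∑ a, k a = N + j + ∑ a, i a

theorem exists_piv {N : ℕ} (d : ℕ) (i : Fin N → ℕ) (hi : StrictMono i) (hd : ∀ a, i a ≤ d)
    (j : ℕ) (hj : j ≤ d) (h : ¬ ∀ a, i a < j) : ∃ s k, IsPiv d s k i j := by
  obtain ⟨s, hs, hsp⟩ := exists_split i hi j
  have hsN : s < N := by
    by_contra hc
    exact h fun a => (hsp a).2 (by omega)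
  let p : Fin (N + 1) := ⟨s, by omega⟩
  let i' : Fin N → ℕ := fun a => i a + if (a : ℕ) < s then 0 else 1
  let k : Fin (N + 1) → ℕ := p.insertNth j i'
  have klo : ∀ a : Fin N, (a : ℕ) < s → i a = k a.castSucc := by
    intro a ha
    have h1 : p.succAbove a = a.castSucc := Fin.succAbove_of_castSucc_lt _ _ (by simpa [p, Fin.lt_def] using ha)
    rw [← h1]
    simp [k, i', ha]
  have khi : ∀ a : Fin N, s ≤ (a : ℕ) → i a + 1 = k a.succ := by
    intro a ha
    have h1 : p.succAbove a = a.succ := Fin.succAbove_of_le_castSucc _ _ (by simpa [p, Fin.le_def] using ha)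
    rw [← h1]
    simp [k, i', ha]
  have kp : k p = j := by simp [k]
  have kp' : ∀ a : Fin (N + 1), (a : ℕ) = s → k a = j := by
    intro a ha
    rw [← kp]; congr 1; exact Fin.ext ha
  refine ⟨s, k, hsN, ?_, ?_, klo, khi, ?_⟩
  · rw [Fin.strictMono_iff_lt_succ]
    intro a
    have h3 := hsp a
    rcases lt_trichotomy ((a : ℕ) + 1) s with h1 | h1 | h1
    · have e1 := klo a (by omega)
      have e2 := klo ⟨a + 1, by omega⟩ h1
      have e3 := hi (show a < ⟨a + 1, by omega⟩ by simp [Fin.lt_def])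
      have e4 : (⟨a + 1, by omega⟩ : Fin N).castSucc = a.succ := by ext; simp
      rw [e4] at e2
      omega
    · have e1 := klo a (by omega)
      have e2 := kp' a.succ (by simp; omega)
      have := h3.2 (by omega)
      omega
    · have e2 := khi a (by omega)
      rcases eq_or_lt_of_le (show s ≤ (a : ℕ) by omega) with h4 | h4
      · have e1 := kp' a.castSucc (by simp; omega)
        omega
      · have e1 := khi ⟨a - 1, by omega⟩ (by simp; omega)
        have e4 : (⟨a - 1, by omega⟩ : Fin N).succ = a.castSucc := by ext; simp; omega
        have e3 := hi (show ⟨a - 1, by omega⟩ < a by simp [Fin.lt_def]; omega)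
        rw [e4] at e1
        omega
  · intro a
    refine Fin.succAboveCases p ?_ (fun b => ?_) a
    · rw [kp]; omega
    · have := hd b
      simp only [k, i', Fin.insertNth_apply_succAbove]
      split_ifs <;> omega
  · rw [Fin.sum_univ_succAbove k p, kp]
    simp only [k, i', Fin.insertNth_apply_succAbove, Finset.sum_add_distrib]
    have h1 : ∑ a : Fin N, (if (a : ℕ) < s then 0 else 1) = N - s := by
      have h2 : ∑ a : Fin N, (if (a : ℕ) < s then 0 else 1) = ∑ a ∈ Finset.range N, (if a < s then 0 else 1) :=
        Fin.sum_univ_eq_sum_range (fun a => if a < s then 0 else 1) N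
      rw [h2]
      obtain ⟨t, rfl⟩ := Nat.exists_eq_add_of_le hs
      rw [Finset.sum_range_add]
      simp +contextual [Finset.sum_ite]
    omega

theorem box_facts {N d s : ℕ} (hs : s < N) {k : Fin (N + 1) → ℕ} (hk : StrictMono k)
    (hd : ∀ a, k a ≤ d + 1) {i : Fin N → ℕ} (hi : i ∈ box k) :
    StrictMono i ∧ (∀ a, i a ≤ d) ∧
    s + ∑ a, k a = N + (s + ∑ a, k a - N - ∑ a, i a) + ∑ a, i a ∧
    k 0 ≤ s + ∑ a, k a - N - ∑ a, i a ∧ s + ∑ a, k a - N - ∑ a, i a < k (Fin.last N) := by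
  simp only [box, Fintype.mem_piFinset, Finset.mem_Ico] at hi
  have h1 : ∑ a, k a = k 0 + ∑ a : Fin N, k a.succ := Fin.sum_univ_succ k
  have h2 : ∑ a, k a = ∑ a : Fin N, k a.castSucc + k (Fin.last N) := Fin.sum_univ_castSucc k
  have h3 : ∑ a, i a + N ≤ ∑ a : Fin N, k a.succ := by
    have : ∑ a, (i a + 1) ≤ ∑ a : Fin N, k a.succ := Finset.sum_le_sum fun a _ => (hi a).2
    simpa [Finset.sum_add_distrib] using this
  have h4 : ∑ a : Fin N, k a.castSucc ≤ ∑ a, i a := Finset.sum_le_sum fun a _ => (hi a).1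
  have h5 : k 0 < k (Fin.last N) := hk (by simp [Fin.lt_def]; omega)
  refine ⟨fun a b hab => ?_, fun a => ?_, by omega, by omega, by omega⟩
  · have := hk.monotone (show a.succ ≤ b.castSucc by
      simp only [Fin.le_def, Fin.val_succ, Fin.val_castSucc]; exact hab)
    have := (hi a).2
    have := (hi b).1
    omega
  · have := (hi a).2
    have := hd a.succ
    omega

theorem IsPiv.mem_box {N d s : ℕ} {k : Fin (N + 1) → ℕ} {i : Fin N → ℕ} {j : ℕ}
    (h : IsPiv d s k i j) : i ∈ box k := by
  simp only [box, Fintype.mem_piFinset, Finset.mem_Ico]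
  intro a
  have := h.mono (Fin.castSucc_lt_succ (i := a))
  rcases lt_or_ge (a : ℕ) s with h1 | h1
  · have := h.lo a h1
    omega
  · have := h.hi a h1
    omega

theorem exists_interval {N : ℕ} (k : Fin (N + 1) → ℕ) (j : ℕ)
    (h0 : k 0 ≤ j) (h1 : j < k (Fin.last N)) : ∃ a : Fin N, k a.castSucc ≤ j ∧ j < k a.succ := by
  by_contra hc
  push Not at hc
  have : ∀ a : Fin (N + 1), k a ≤ j := fun a => Fin.induction h0 (fun a h => hc a h) a
  have := this (Fin.last N)
  omega

theorem interval_unique {N : ℕ} {k : Fin (N + 1) → ℕ} (hk : StrictMono k) {j : ℕ} {a b : Fin N}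
    (ha : k a.castSucc ≤ j) (ha' : j < k a.succ) (hb : k b.castSucc ≤ j) (hb' : j < k b.succ) :
    a = b := by
  have h1 : a.castSucc < b.succ := hk.lt_iff_lt.1 (by omega)
  have h2 : b.castSucc < a.succ := hk.lt_iff_lt.1 (by omega)
  simp only [Fin.lt_def, Fin.val_castSucc, Fin.val_succ] at h1 h2
  ext; omega

theorem mu_Fp (d N : ℕ) (i : Fin N → ℕ) (j : ℕ) :
    mu F d N (Fp F d i j) = wedge F d (Fin.snoc i j : Fin (N + 1) → ℕ) := by
  apply Subtype.ext
  simp only [mu, Fp, wedge, TensorProduct.lift.tmul, LinearMap.mk₂_apply, ExteriorAlgebra.ιMulti_apply]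
  rw [List.ofFn_succ']
  simp [List.concat_eq_append]

theorem mu_vv (d N s : ℕ) (hs : s < N) (k : Fin (N + 1) → ℕ) (hk : StrictMono k)
    (hd : ∀ a, k a ≤ d + 1) : mu F d N (vv F d N s k) = 0 := by
  classical
  rw [vv, map_sum]
  simp only [mu_Fp]
  set J : (Fin N → ℕ) → ℕ := fun i => s + ∑ a, k a - N - ∑ a, i a with hJ
  have hex : ∀ i ∈ box k, ∃ a : Fin N, k a.castSucc ≤ J i ∧ J i < k a.succ := fun i hi =>
    exists_interval k _ (box_facts hs hk hd hi).2.2.2.1 (box_facts hs hk hd hi).2.2.2.2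
  choose A hA hA' using hex
  have hmem : ∀ i (hi : i ∈ box k), Function.update i (A i hi) (J i) ∈ box k := by
    intro i hi
    have hi' := hi
    simp only [box, Fintype.mem_piFinset, Finset.mem_Ico] at hi' ⊢
    intro b
    by_cases hb : b = A i hi
    · subst hb
      simpa using ⟨hA i hi, hA' i hi⟩
    · simpa [Function.update_of_ne hb] using hi' b
  have hJ' : ∀ i (hi : i ∈ box k), J (Function.update i (A i hi) (J i)) = i (A i hi) := by
    intro i hi
    have e1 := (box_facts hs hk hd hi).2.2.1
    have e2 := (box_facts hs hk hd (hmem i hi)).2.2.1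
    have e3 : ∑ a, Function.update i (A i hi) (J i) a + i (A i hi) = ∑ a, i a + J i := by
      rw [Finset.sum_update_of_mem (Finset.mem_univ _), ← Finset.add_sum_erase _ _ (Finset.mem_univ (A i hi)),
        Finset.sdiff_singleton_eq_erase]
      ring
    simp only [hJ] at e3 ⊢
    omega
  refine Finset.sum_involution (fun i hi => Function.update i (A i hi) (J i)) ?_ ?_ hmem ?_
  · intro i hi
    have hsw : (fun a => XY F d ((Fin.snoc (Function.update i (A i hi) (J i))
        (J (Function.update i (A i hi) (J i))) : Fin (N + 1) → ℕ) a)) =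
        (fun a => XY F d ((Fin.snoc i (J i) : Fin (N + 1) → ℕ) a)) ∘
          Equiv.swap (A i hi).castSucc (Fin.last N) := by
      rw [hJ' i hi]
      funext a
      simp only [Function.comp]
      congr 1
      refine Fin.lastCases ?_ (fun b => ?_) a
      · simp
      · by_cases hb : b = A i hi
        · subst hb; simp
        · rw [Equiv.swap_apply_of_ne_of_ne (by simpa using hb) (Fin.castSucc_lt_last b).ne]
          simp [Function.update_of_ne hb]
    apply Subtype.ext
    change (ExteriorAlgebra.ιMulti F (N + 1)) _ + (ExteriorAlgebra.ιMulti F (N + 1)) _ = 0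
    rw [hsw, AlternatingMap.map_swap _ _ (Fin.castSucc_lt_last _).ne]
    exact add_neg_cancel _
  · intro i hi hne heq
    apply hne
    have h1 : i (A i hi) = J i := by
      have h2 := congrFun heq (A i hi)
      rw [Function.update_self] at h2
      exact h2.symm
    apply Subtype.ext
    change (ExteriorAlgebra.ιMulti F (N + 1)) _ = 0
    refine AlternatingMap.map_eq_zero_of_eq _ _ (i := (A i hi).castSucc) (j := Fin.last N) ?_
      (Fin.castSucc_lt_last _).ne
    simp only [Fin.snoc_castSucc, Fin.snoc_last, h1]
    rfl
  · intro i hi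
    have hi' := hi
    simp only [box, Fintype.mem_piFinset, Finset.mem_Ico] at hi'
    have hA1 : A _ (hmem i hi) = A i hi := by
      have e1 := hA _ (hmem i hi)
      have e2 := hA' _ (hmem i hi)
      rw [hJ' i hi] at e1 e2
      exact interval_unique hk e1 e2 (hi' _).1 (hi' _).2
    change Function.update (Function.update i (A i hi) (J i)) (A _ (hmem i hi)) (J _) = i
    rw [hA1, hJ' i hi]
    simp

theorem XY_val (d i : ℕ) (h : i ≤ d) : (XY F d i : MvPolynomial (Fin 2) F) =
    MvPolynomial.monomial (Finsupp.single 0 (d - i) + Finsupp.single 1 i) 1 := by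
  rw [XY, dif_pos h]
  simp only [MvPolynomial.X_pow_eq_monomial, MvPolynomial.monomial_mul, mul_one]

theorem XY_li (d : ℕ) : LinearIndependent F (fun i : Fin (d + 1) => XY F d i) := by
  apply LinearIndependent.of_comp (Submodule.subtype _)
  have h := (MvPolynomial.basisMonomials (Fin 2) F).linearIndependent
  have hinj : Function.Injective (fun i : Fin (d + 1) =>
      (Finsupp.single 0 (d - (i : ℕ)) + Finsupp.single 1 (i : ℕ) : Fin 2 →₀ ℕ)) := by
    intro a b hab
    have := DFunLike.congr_fun hab 1
    simpa [Fin.ext_iff] using this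
  convert h.comp _ hinj using 1
  funext i
  simp [XY_val F d i (by omega)]

theorem XY_span (d : ℕ) :
    Submodule.span F (Set.range (fun i : Fin (d + 1) => XY F d i)) = ⊤ := by
  apply Submodule.map_injective_of_injective (Submodule.injective_subtype _)
  rw [Submodule.map_span, Submodule.map_top, Submodule.range_subtype]
  apply le_antisymm
  · rw [Submodule.span_le]
    rintro _ ⟨x, -, rfl⟩
    exact x.2
  · intro p hp
    rw [MvPolynomial.mem_homogeneousSubmodule] at hp
    rw [MvPolynomial.as_sum p]
    refine Submodule.sum_mem _ fun v hv => ?_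
    have hdeg : v.degree = d := by
      have := hp (MvPolynomial.mem_support_iff.1 hv)
      rwa [Finsupp.degree_eq_weight_one]
    have hsum : v 0 + v 1 = d := by
      rw [← hdeg, Finsupp.degree_eq_sum]; simp [Fin.sum_univ_two]
    have hv' : v = Finsupp.single 0 (d - v 1) + Finsupp.single 1 (v 1) := by
      ext a
      fin_cases a
      · simp; omega
      · simp
    have : MvPolynomial.monomial v (MvPolynomial.coeff v p) =
        MvPolynomial.coeff v p • (XY F d (v 1) : MvPolynomial (Fin 2) F) := by
      rw [XY_val F d (v 1) (by omega), ← hv', MvPolynomial.smul_monomial]; simp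
    rw [this]
    refine Submodule.smul_mem _ _ (Submodule.subset_span ⟨XY F d (v 1), ⟨⟨v 1, by omega⟩, rfl⟩, rfl⟩)

/-- The family of top vectors, mapped by `mu` to a linearly independent family. -/
def topFam (d N : ℕ) (t : Set.powersetCard (Fin (d + 1)) (N + 1)) :
    (⋀[F]^N (Sym' F d)) ⊗[F] (Sym' F d) :=
  Fp F d (fun a : Fin N => (Set.powersetCard.ofFinEmbEquiv.symm t a.castSucc : ℕ))
    (Set.powersetCard.ofFinEmbEquiv.symm t (Fin.last N) : ℕ)

theorem mu_topFam (d N : ℕ) (t : Set.powersetCard (Fin (d + 1)) (N + 1)) :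
    mu F d N (topFam F d N t) =
      exteriorPower.ιMulti_family F (N + 1) (fun i : Fin (d + 1) => XY F d i) t := by
  rw [topFam, mu_Fp]
  apply Subtype.ext
  change (ExteriorAlgebra.ιMulti F (N + 1)) _ = (ExteriorAlgebra.ιMulti F (N + 1)) _
  congr 1
  funext a
  refine Fin.lastCases ?_ (fun b => ?_) a <;> simp

theorem Fp_top_mem (d N : ℕ) (i : Fin N → ℕ) (hi : StrictMono i) (j : ℕ) (hj : j ≤ d)
    (h : ∀ a, i a < j) : Fp F d i j ∈ Submodule.span F (Set.range (topFam F d N)) := by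
  have hb : ∀ a : Fin (N + 1), (Fin.snoc i j : Fin (N + 1) → ℕ) a < d + 1 := by
    intro a
    refine Fin.lastCases ?_ (fun b => ?_) a
    · simp; omega
    · have := h b
      simp; omega
  have hm : StrictMono (fun a : Fin (N + 1) =>
      (⟨(Fin.snoc i j : Fin (N + 1) → ℕ) a, hb a⟩ : Fin (d + 1))) := by
    intro a b
    refine Fin.lastCases ?_ (fun b => ?_) b
    · refine Fin.lastCases ?_ (fun a => ?_) a
      · simp
      · intro _
        simpa using h a
    · refine Fin.lastCases ?_ (fun a => ?_) a
      · intro h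
        exact absurd h (Fin.castSucc_lt_last b).not_gt
      · intro h
        simpa using hi (by simpa using h)
  refine Submodule.subset_span ⟨Set.powersetCard.ofFinEmbEquiv (OrderEmbedding.ofStrictMono _ hm), ?_⟩
  rw [topFam]
  simp

theorem Fp_mem (d N : ℕ) (i : Fin N → ℕ) (hi : StrictMono i) (hd : ∀ a, i a ≤ d)
    (j : ℕ) (hj : j ≤ d) : Fp F d i j ∈
    Submodule.span F {x | ∃ s < N, ∃ k : Fin (N + 1) → ℕ,
          StrictMono k ∧ (∀ a, k a ≤ d + 1) ∧ x = vv F d N s k} ⊔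
      Submodule.span F (Set.range (topFam F d N)) := by
  classical
  set W := Submodule.span F {x | ∃ s < N, ∃ k : Fin (N + 1) → ℕ,
          StrictMono k ∧ (∀ a, k a ≤ d + 1) ∧ x = vv F d N s k} ⊔
      Submodule.span F (Set.range (topFam F d N)) with hW
  let bad : Set (ℕ × (Fin (N + 1) → ℕ)) :=
    {p | ∃ i j, IsPiv d p.1 p.2 i j ∧ Fp F d i j ∉ W}
  have hfin : bad.Finite := by
    have : (Set.Iic N ×ˢ Set.Iic (fun _ : Fin (N + 1) => d + 1)).Finite :=
      (Set.finite_Iic _).prod (Set.finite_Iic _)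
    refine this.subset ?_
    rintro ⟨s, k⟩ ⟨i, j, h, -⟩
    exact ⟨h.hs.le, h.bd⟩
  have hempty : bad = ∅ := by
    by_contra hne
    obtain ⟨⟨s, k⟩, ⟨i, j, hp, hnot⟩, hmax⟩ := Set.exists_max_image bad
      (fun p => toLex (fun m : Fin (N + 1) => 2 * p.2 m + if p.1 = m then 0 else 1)) hfin
      (Set.nonempty_iff_ne_empty.2 hne)
    replace hp : IsPiv d s k i j := hp
    apply hnot
    have hs := hp.hs
    have hv : vv F d N s k ∈ W := by
      apply Submodule.mem_sup_left
      exact Submodule.subset_span ⟨s, hp.hs, k, hp.mono, hp.bd, rfl⟩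
    have hj0 : s + ∑ a, k a - N - ∑ a, i a = j := by
      have := hp.sum
      omega
    rw [vv, ← Finset.add_sum_erase _ _ hp.mem_box, hj0] at hv
    suffices hsum : ∑ x ∈ (box k).erase i, Fp F d x (s + ∑ a, k a - N - ∑ a, x a) ∈ W from
      mem_of_add_mem W hsum hv
    refine Submodule.sum_mem _ fun i' hi' => ?_
    rw [Finset.mem_erase] at hi'
    obtain ⟨f1, f2, f3, f4, f5⟩ := box_facts hs hp.mono hp.bd hi'.2
    have hjd : s + ∑ a, k a - N - ∑ a, i' a ≤ d := by
      have := hp.bd (Fin.last N)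
      omega
    generalize s + ∑ a, k a - N - ∑ a, i' a = j' at *
    by_cases htop : ∀ a, i' a < j'
    · exact Submodule.mem_sup_right (Fp_top_mem F d N i' f1 j' hjd htop)
    · obtain ⟨s', k', hp'⟩ := exists_piv d i' f1 f2 j' hjd htop
      by_contra hbad
      have hle := hmax (s', k') ⟨i', j', hp', hbad⟩
      have hbox := hi'.2
      simp only [box, Fintype.mem_piFinset, Finset.mem_Ico] at hbox
      have g1 : ∀ a : Fin (N + 1), (a : ℕ) < s' → k a ≤ k' a := by
        intro a ha
        have hs'' := hp'.hs
        have e := hp'.lo ⟨a, by omega⟩ ha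
        have e' := (hbox ⟨a, by omega⟩).1
        have e4 : (⟨a, by omega⟩ : Fin N).castSucc = a := by ext; simp
        rw [e4] at e e'
        omega
      have g2 : ∀ a : Fin (N + 1), s' < (a : ℕ) → k' a ≤ k a := by
        intro a ha
        have e := hp'.hi ⟨a - 1, by omega⟩ (by simp; omega)
        have e' := (hbox ⟨a - 1, by omega⟩).2
        have e4 : (⟨a - 1, by omega⟩ : Fin N).succ = a := by ext; simp; omega
        rw [e4] at e e'
        omega
      have g3 : s + ∑ a, k a = s' + ∑ a, k' a := by
        rw [hp'.sum, f3]
      have hcmp := key_compare s s' k k' hp'.hs g1 g2 g3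
      rcases hcmp with h | h
      · obtain ⟨rfl, rfl⟩ := h
        apply hi'.1
        funext a
        rcases lt_or_ge (a : ℕ) s with h1 | h1
        · rw [hp.lo a h1, hp'.lo a h1]
        · have := hp.hi a h1
          have := hp'.hi a h1
          omega
      · exact absurd hle (not_le.2 h)
  by_cases htop : ∀ a, i a < j
  · exact Submodule.mem_sup_right (Fp_top_mem F d N i hi j hj htop)
  · obtain ⟨s, k, hp⟩ := exists_piv d i hi hd j hj htop
    by_contra hc
    have : (s, k) ∈ bad := ⟨i, j, hp, hc⟩
    rw [hempty] at this
    exact this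

theorem sup_eq_top (d N : ℕ) :
    Submodule.span F {x | ∃ s < N, ∃ k : Fin (N + 1) → ℕ,
          StrictMono k ∧ (∀ a, k a ≤ d + 1) ∧ x = vv F d N s k} ⊔
      Submodule.span F (Set.range (topFam F d N)) = ⊤ := by
  rw [eq_top_iff, ← TensorProduct.map₂_mk_top_top_eq_top, ← XY_span F d,
    ← exteriorPower.ιMulti_family_span_of_span F (n := N) (XY_span F d),
    Submodule.map₂_span_span, Submodule.span_le]
  rintro _ ⟨_, ⟨t, rfl⟩, _, ⟨j, rfl⟩, rfl⟩
  exact Fp_mem F d N (fun a => (Set.powersetCard.ofFinEmbEquiv.symm t a : ℕ))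
    (fun a b hab => (Set.powersetCard.ofFinEmbEquiv.symm t).strictMono hab)
    (fun a => by have := (Set.powersetCard.ofFinEmbEquiv.symm t a).2; omega) j (by omega)

/-- final Corollary of Section 2 of the paper. The vectors `v_{(s,k)}`, for
`s ∈ {0,…,N-1}` and strictly increasing `k ∈ I(d+1, N+1)`, span
`Δ^{(2,1^{N-1})} Sym^d E = ker μ_N`. -/
theorem statement17 (F : Type*) [Field F] (N d : ℕ) (hN : 0 < N) :
    Submodule.span F
        {x | ∃ s < N, ∃ k : Fin (N + 1) → ℕ,
          StrictMono k ∧ (∀ a, k a ≤ d + 1) ∧ x = vv F d N s k}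
      = LinearMap.ker (mu F d N) := by
  have hle : Submodule.span F
        {x | ∃ s < N, ∃ k : Fin (N + 1) → ℕ,
          StrictMono k ∧ (∀ a, k a ≤ d + 1) ∧ x = vv F d N s k}
      ≤ LinearMap.ker (mu F d N) := by
    rw [Submodule.span_le]
    rintro _ ⟨s, hs, k, hk, hd, rfl⟩
    exact mu_vv F d N s hs k hk hd
  apply le_antisymm hle
  intro x hx
  have hx' := (sup_eq_top F d N).ge (Submodule.mem_top (x := x))
  obtain ⟨y, hy, z, hz, rfl⟩ := Submodule.mem_sup.1 hx'
  have hz0 : mu F d N z = 0 := by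
    have h1 : mu F d N y = 0 := hle hy
    have h2 : mu F d N (y + z) = 0 := hx
    rwa [map_add, h1, zero_add] at h2
  obtain ⟨c, rfl⟩ := Finsupp.mem_span_range_iff_exists_finsupp.1 hz
  have hli := exteriorPower.ιMulti_family_linearIndependent_field (n := N + 1) (XY_li F d)
  have hc : c = 0 := by
    rw [linearIndependent_iff] at hli
    apply hli
    rw [Finsupp.linearCombination_apply, ← hz0, Finsupp.sum, Finsupp.sum, map_sum]
    refine Finset.sum_congr rfl fun t _ => ?_
    rw [map_smul, mu_topFam]
  rw [hc]
  simpa using hy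

end
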